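/- arXiv:0906.4309 — 3 statements merged into one kernel-verified Lean document; each statement's English description precedes it below -/
import Mathlib

section
/- Let λ₁, λ₂ ∈ k with λ₁ ≠ 0 and λ₂ ≠ 0, let φ₁, φ₂ be nonzero linear forms in k[x,y], and set P₁ = λ₁·φ₁³ and P₂ = λ₂·φ₂³. Then there exists g ∈ SL(2,k) with g·P₁ = P₂ if and only if λ₁/λ₂ is a cube in k*. -/
open MvPolynomial

/-- A binary cubic `a·x³ + 3b·x²y + 3c·xy² + d·y³`, recorded by its coefficients. -/
structure BinCubic (k : Type*) where
  a : k
  b : k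
  c : k
  d : k

namespace BinCubic

variable {k : Type*} [Field k]

instance : Zero (BinCubic k) := ⟨⟨0, 0, 0, 0⟩⟩

instance : Add (BinCubic k) :=
  ⟨fun P Q => ⟨P.a + Q.a, P.b + Q.b, P.c + Q.c, P.d + Q.d⟩⟩

instance : Neg (BinCubic k) := ⟨fun P => ⟨-P.a, -P.b, -P.c, -P.d⟩⟩

instance : Sub (BinCubic k) :=
  ⟨fun P Q => ⟨P.a - Q.a, P.b - Q.b, P.c - Q.c, P.d - Q.d⟩⟩

instance : SMul k (BinCubic k) := ⟨fun t P => ⟨t * P.a, t * P.b, t * P.c, t * P.d⟩⟩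

/-- The homogeneous cubic polynomial in `k[x,y]` attached to a binary cubic. -/
noncomputable def toPoly (P : BinCubic k) : MvPolynomial (Fin 2) k :=
  C P.a * X 0 ^ 3 + C (3 * P.b) * X 0 ^ 2 * X 1 +
    C (3 * P.c) * X 0 * X 1 ^ 2 + C P.d * X 1 ^ 3

/-- The linear form `e·x + f·y`. -/
noncomputable def lin (e f : k) : MvPolynomial (Fin 2) k := C e * X 0 + C f * X 1

/-- A binary quadratic `u·x² + v·xy + w·y²`. -/
noncomputable def quadPoly (u v w : k) : MvPolynomial (Fin 2) k :=
  C u * X 0 ^ 2 + C v * (X 0 * X 1) + C w * X 1 ^ 2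

/-- The moment map `μ`. -/
def mu (P : BinCubic k) : Matrix (Fin 2) (Fin 2) k :=
  !![P.a * P.d - P.b * P.c, 2 * (P.b * P.d - P.c ^ 2);
     2 * (P.b ^ 2 - P.a * P.c), -(P.a * P.d - P.b * P.c)]

/-- The normalized quartic invariant `Q_n`. -/
def Qn (P : BinCubic k) : k :=
  P.a ^ 2 * P.d ^ 2 - 3 * P.b ^ 2 * P.c ^ 2 - 6 * P.a * P.b * P.c * P.d +
    4 * P.b ^ 3 * P.d + 4 * P.a * P.c ^ 3

/-- The derivation action of the trace-free matrix `M = [[α,β],[γ,−α]]` on binary cubics,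
induced by `M·x = −αx − βy`, `M·y = −γx + αy`.  Explicitly,
`M·P = (−3aα−3bγ)x³ + (−3aβ−3bα−6cγ)x²y + (−6bβ+3cα−3dγ)xy² + (−3cβ+3dα)y³`. -/
def matAct (M : Matrix (Fin 2) (Fin 2) k) (P : BinCubic k) : BinCubic k :=
  ⟨-(3 * P.a * M 0 0) - 3 * P.b * M 1 0,
   -(P.a * M 0 1) - P.b * M 0 0 - 2 * P.c * M 1 0,
   -(2 * P.b * M 0 1) + P.c * M 0 0 - P.d * M 1 0,
   -(3 * P.c * M 0 1) + 3 * P.d * M 0 0⟩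

/-- The cubic covariant `Ψ(P) = μ(P)·P`. -/
def Psi (P : BinCubic k) : BinCubic k := matAct (mu P) P

/-- The symplectic form `ω` on binary cubics. -/
def omega (P Q : BinCubic k) : k :=
  P.a * Q.d - P.d * Q.a - 3 * P.b * Q.c + 3 * P.c * Q.b

/-- `λ·(ex+fy)³` as a binary cubic. -/
def cubeForm (lam e f : k) : BinCubic k :=
  ⟨lam * e ^ 3, lam * e ^ 2 * f, lam * e * f ^ 2, lam * f ^ 3⟩

/-- The action on binary cubics of the algebra substitution `x ↦ px + qy`, `y ↦ rx + sy`. -/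
def substAct (p q r s : k) (P : BinCubic k) : BinCubic k :=
  ⟨P.a * p ^ 3 + 3 * P.b * p ^ 2 * r + 3 * P.c * p * r ^ 2 + P.d * r ^ 3,
   P.a * p ^ 2 * q + P.b * (p ^ 2 * s + 2 * p * q * r) + P.c * (2 * p * r * s + q * r ^ 2) +
     P.d * r ^ 2 * s,
   P.a * p * q ^ 2 + P.b * (2 * p * q * s + q ^ 2 * r) + P.c * (p * s ^ 2 + 2 * q * r * s) +
     P.d * r * s ^ 2,
   P.a * q ^ 3 + 3 * P.b * q ^ 2 * s + 3 * P.c * q * s ^ 2 + P.d * s ^ 3⟩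

/-- `M^{⊗3}` acting on binary cubics for a trace-free `M = [[α,β],[γ,−α]]`: the algebra
substitution `x ↦ −αx − βy`, `y ↦ −γx + αy`; it sends `φ³` to `(M·φ)³` for linear forms `φ`. -/
def tensorCubeAct (M : Matrix (Fin 2) (Fin 2) k) (P : BinCubic k) : BinCubic k :=
  substAct (-(M 0 0)) (-(M 0 1)) (-(M 1 0)) (M 0 0) P

/-- Action of a trace-free matrix `M = [[α,β],[γ,−α]]` on the linear form `ex + fy`
(`M·x = −αx − βy`, `M·y = −γx + αy`), recorded by the resulting pair of coefficients. -/
def linAct (M : Matrix (Fin 2) (Fin 2) k) (e f : k) : k × k :=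
  (-(e * M 0 0) - f * M 1 0, -(e * M 0 1) + f * M 0 0)

/-- Evaluation of `P` at the point `(u, w) ∈ k²`. -/
def evalAt (P : BinCubic k) (u w : k) : k :=
  P.a * u ^ 3 + 3 * P.b * u ^ 2 * w + 3 * P.c * u * w ^ 2 + P.d * w ^ 3

/-- The symplectic form `Ω` on `k²`. -/
def Omeg (v w : Fin 2 → k) : k := v 0 * w 1 - v 1 * w 0

/-- The action of `g = [[α,β],[γ,δ]]` on polynomials by the algebra substitution
`g·x = δx − βy`, `g·y = −γx + αy`. -/
noncomputable def slAct (g : Matrix (Fin 2) (Fin 2) k) (P : MvPolynomial (Fin 2) k) :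
    MvPolynomial (Fin 2) k :=
  aeval ![C (g 1 1) * X 0 - C (g 0 1) * X 1, C (g 0 0) * X 1 - C (g 1 0) * X 0] P

/-- The symmetric bilinear polarization `B_μ` of the moment map: `B_μ(P,P) = μ(P)`. -/
def Bmu (P Q : BinCubic k) : Matrix (Fin 2) (Fin 2) k :=
  !![(P.a * Q.d + P.d * Q.a - P.b * Q.c - P.c * Q.b) / 2,
       (P.b * Q.d + P.d * Q.b) - P.c * Q.c;
     P.b * Q.b - (P.a * Q.c + P.c * Q.a),
       -((P.a * Q.d + P.d * Q.a - P.b * Q.c - P.c * Q.b) / 2)]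

/-- `P` is reducible over `k`: it factors as (nonzero linear form)·(binary quadratic). -/
def IsReducible (P : BinCubic k) : Prop :=
  ∃ e f u v w : k, (e ≠ 0 ∨ f ≠ 0) ∧ toPoly P = lin e f * quadPoly u v w

end BinCubic

namespace BinCubic

variable {k : Type*} [Field k]

theorem toPoly_cubeForm (lam e f : k) : toPoly (cubeForm lam e f) = C lam * lin e f ^ 3 := by
  simp only [toPoly, cubeForm, lin, map_mul, map_pow, map_ofNat]
  ring

theorem slAct_C_mul_lin_pow (g : Matrix (Fin 2) (Fin 2) k) (lam e f : k) (n : ℕ) :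
    slAct g (C lam * lin e f ^ n) =
      C lam * lin (e * g 1 1 - f * g 1 0) (f * g 0 0 - e * g 0 1) ^ n := by
  simp only [slAct, lin, map_mul, map_pow, map_add, map_sub, aeval_X, algHom_C,
    MvPolynomial.algebraMap_eq, Matrix.cons_val_zero, Matrix.cons_val_one]
  ring

theorem eval_lin (e f : k) (v : Fin 2 → k) : eval v (lin e f) = e * v 0 + f * v 1 := by
  simp [lin]

theorem lin_smul (r e f : k) : lin (r * e) (r * f) = C r * lin e f := by
  simp only [lin, map_mul]
  ring

/-- `SL(2,k)` acts transitively on nonzero linear forms. -/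
theorem exists_specialLinearGroup_map_lin {e f E F : k} (h : e ≠ 0 ∨ f ≠ 0)
    (H : E ≠ 0 ∨ F ≠ 0) : ∃ g : Matrix.SpecialLinearGroup (Fin 2) k,
      e * g.1 1 1 - f * g.1 1 0 = E ∧ f * g.1 0 0 - e * g.1 0 1 = F := by
  suffices ∃ p q r s : k, p * s - q * r = 1 ∧ e * s - f * r = E ∧ f * p - e * q = F by
    obtain ⟨p, q, r, s, hdet, hE, hF⟩ := this
    exact ⟨⟨!![p, q; r, s], by rw [Matrix.det_fin_two_of, hdet]⟩, by simpa using hE,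
      by simpa using hF⟩
  have hbezout : ∀ t : k, ∃ u v : k, u * E + v * F = t := by
    intro t
    rcases H with H | H
    · exact ⟨t / E, 0, by field_simp; ring⟩
    · exact ⟨0, t / F, by field_simp; ring⟩
  rcases h with h | h
  · obtain ⟨p, r, hpr⟩ := hbezout e
    refine ⟨p, (f * p - F) / e, r, (E + f * r) / e, ?_, ?_, ?_⟩ <;> field_simp
    · linear_combination hpr
    · ring
    · ring
  · obtain ⟨q, s, hqs⟩ := hbezout f
    refine ⟨(F + e * q) / f, q, (e * s - E) / f, s, ?_, ?_, ?_⟩ <;> field_simp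
    · linear_combination hqs
    · ring
    · ring

theorem exists_cube_of_C_mul_lin_pow_eq {lam1 lam2 e1 f1 e2 f2 : k} (hl2 : lam2 ≠ 0)
    (h : e2 ≠ 0 ∨ f2 ≠ 0) (heq : C lam1 * lin e1 f1 ^ 3 = C lam2 * lin e2 f2 ^ 3) :
    ∃ r : k, r ≠ 0 ∧ lam1 / lam2 = r ^ 3 := by
  have key : ∀ s t : k, t ≠ 0 → lam1 * s ^ 3 = lam2 * t ^ 3 →
      ∃ r : k, r ≠ 0 ∧ lam1 / lam2 = r ^ 3 := by
    intro s t ht hst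
    have hs : s ≠ 0 := by
      rintro rfl
      exact mul_ne_zero hl2 (pow_ne_zero 3 ht) (by rw [← hst]; ring)
    refine ⟨t / s, div_ne_zero ht hs, ?_⟩
    field_simp
    linear_combination hst
  rcases h with h | h
  · exact key e1 e2 h (by simpa [eval_lin] using congrArg (eval ![1, 0]) heq)
  · exact key f1 f2 h (by simpa [eval_lin] using congrArg (eval ![0, 1]) heq)

end BinCubic

open BinCubic
/-- `λ₁φ₁³` and `λ₂φ₂³` are in the same `SL(2,k)`-orbit iff `λ₁/λ₂` is a cube
in `k*`. -/
theorem stmt7 {k : Type*} [Field k] (h2 : (2 : k) ≠ 0) (h3 : (3 : k) ≠ 0)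
    (lam1 lam2 e1 f1 e2 f2 : k) (hl1 : lam1 ≠ 0) (hl2 : lam2 ≠ 0)
    (hphi1 : e1 ≠ 0 ∨ f1 ≠ 0) (hphi2 : e2 ≠ 0 ∨ f2 ≠ 0) :
    (∃ g : Matrix.SpecialLinearGroup (Fin 2) k,
        slAct (↑g) (toPoly (cubeForm lam1 e1 f1)) = toPoly (cubeForm lam2 e2 f2)) ↔
      ∃ r : k, r ≠ 0 ∧ lam1 / lam2 = r ^ 3 := by
  simp only [toPoly_cubeForm, slAct_C_mul_lin_pow]
  constructor
  · rintro ⟨g, hg⟩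
    exact exists_cube_of_C_mul_lin_pow_eq hl2 hphi2 hg
  · rintro ⟨r, hr, hlam⟩
    obtain ⟨g, hE, hF⟩ := exists_specialLinearGroup_map_lin (E := r⁻¹ * e2) (F := r⁻¹ * f2)
      hphi1 (hphi2.imp (mul_ne_zero (inv_ne_zero hr)) (mul_ne_zero (inv_ne_zero hr)))
    refine ⟨g, ?_⟩
    rw [hE, hF, lin_smul, mul_pow, ← mul_assoc, ← map_pow, ← map_mul,
      (div_eq_iff hl2).mp hlam]
    congr 2
    field_simp
end

section
/- Let P be a binary cubic over k such that μ(P) is nonzero and nilpotent. Then there exists a unique pair (φ, ξ) of linear forms in k[x,y] such that P = φ²·ξ and Ω(φ,ξ) = 1. -/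
open MvPolynomial

open BinCubic
namespace BinCubic

/-- Two cubics in `x, y` agree as polynomials iff their coefficients agree. -/
lemma cubic_poly_inj {k : Type*} [Field k] {a b c d a' b' c' d' : k} :
    (C a * X 0 ^ 3 + C b * X 0 ^ 2 * X 1 + C c * X 0 * X 1 ^ 2 + C d * X 1 ^ 3 :
        MvPolynomial (Fin 2) k) =
      C a' * X 0 ^ 3 + C b' * X 0 ^ 2 * X 1 + C c' * X 0 * X 1 ^ 2 + C d' * X 1 ^ 3 ↔
    a = a' ∧ b = b' ∧ c = c' ∧ d = d' := by
  constructor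
  · intro h
    have h' := congrArg (aeval ![(Polynomial.X : Polynomial k), 1]) h
    have h'' : (Cubic.mk a b c d).toPoly = (Cubic.mk a' b' c' d').toPoly := by
      simpa [Cubic.toPoly, algHom_C] using h'
    simpa using (Cubic.toPoly_injective _ _).1 h''
  · rintro ⟨rfl, rfl, rfl, rfl⟩
    rfl

lemma toPoly_eq_lin_sq_mul_lin_iff {k : Type*} [Field k] (P : BinCubic k) (e f g h : k) :
    toPoly P = lin e f ^ 2 * lin g h ↔
      P.a = e ^ 2 * g ∧ 3 * P.b = e ^ 2 * h + 2 * e * f * g ∧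
        3 * P.c = 2 * e * f * h + f ^ 2 * g ∧ P.d = f ^ 2 * h := by
  have hexp : lin e f ^ 2 * lin g h =
      C (e ^ 2 * g) * X 0 ^ 3 + C (e ^ 2 * h + 2 * e * f * g) * X 0 ^ 2 * X 1 +
        C (2 * e * f * h + f ^ 2 * g) * X 0 * X 1 ^ 2 + C (f ^ 2 * h) * X 1 ^ 3 := by
    have hC2 : (C 2 : MvPolynomial (Fin 2) k) = 2 := map_ofNat C 2
    simp only [lin, map_mul, map_add, map_pow, hC2]
    ring
  rw [hexp, toPoly, cubic_poly_inj]

/-- A cubic with degenerate Hessian and `b² ≠ ac` is `φ²ξ` with `Ω(φ,ξ) = 1`. -/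
lemma exists_coeffs_of_hessian_ne_zero {k : Type*} [Field k] (h2 : (2 : k) ≠ 0)
    (h3 : (3 : k) ≠ 0) {a b c d : k} (hA : b ^ 2 - a * c ≠ 0)
    (hdisc : (a * d - b * c) ^ 2 = 4 * (b ^ 2 - a * c) * (c ^ 2 - b * d)) :
    ∃ e f g h : k, a = e ^ 2 * g ∧ 3 * b = e ^ 2 * h + 2 * e * f * g ∧
      3 * c = 2 * e * f * h + f ^ 2 * g ∧ d = f ^ 2 * h ∧ e * h - f * g = 1 := by
  obtain ⟨A, hAdef⟩ : ∃ A, A = b ^ 2 - a * c := ⟨_, rfl⟩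
  obtain ⟨B, hBdef⟩ : ∃ B, B = a * d - b * c := ⟨_, rfl⟩
  obtain ⟨D, hDdef⟩ : ∃ D, D = c ^ 2 - b * d := ⟨_, rfl⟩
  rw [← hAdef] at hA
  rw [← hAdef, ← hBdef, ← hDdef] at hdisc
  have hc : a * D + b * B + c * A = 0 := by subst hAdef hBdef hDdef; ring
  have hd : b * D + c * B + d * A = 0 := by subst hAdef hBdef hDdef; ring
  have hA2 : a ^ 2 * D + a * b * B + b ^ 2 * A = A ^ 2 := by subst hAdef hBdef hDdef; ring
  clear hAdef hBdef hDdef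
  obtain ⟨e, he⟩ : ∃ e, 2 * A * e = 3 * (a * B + 2 * b * A) :=
    ⟨3 * (a * B + 2 * b * A) / (2 * A), by field_simp⟩
  have he2 : e ^ 2 = 9 * A := by
    have : (2 * A) ^ 2 * (e ^ 2 - 9 * A) = 0 := by
      linear_combination (2 * A * e + 3 * (a * B + 2 * b * A)) * he + 9 * a ^ 2 * hdisc +
        36 * A * hA2
    simpa [h2, hA, sub_eq_zero] using this
  have h9 : (9 : k) ≠ 0 := by
    rw [show (9 : k) = 3 * 3 by norm_num]; exact mul_ne_zero h3 h3
  have he0 : e ≠ 0 := by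
    rintro rfl
    exact mul_ne_zero h9 hA (by rw [← he2]; ring)
  obtain ⟨f, hf⟩ : ∃ f, 2 * e * f = -9 * B := ⟨-9 * B / (2 * e), by field_simp⟩
  obtain ⟨g, hg⟩ : ∃ g, a = e ^ 2 * g := ⟨a / e ^ 2, by field_simp⟩
  obtain ⟨h, hh⟩ : ∃ h, e * h = 1 + f * g := ⟨(1 + f * g) / e, by field_simp⟩
  have hf2 : f ^ 2 = 9 * D := by
    have : 4 * e ^ 2 * (f ^ 2 - 9 * D) = 0 := by
      linear_combination (2 * e * f - 9 * B) * hf + 81 * hdisc - 36 * D * he2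
    have h4 : (4 : k) ≠ 0 := by
      rw [show (4 : k) = 2 * 2 by norm_num]; exact mul_ne_zero h2 h2
    simpa [h4, he0, sub_eq_zero] using this
  have hb3 : 3 * b = e + 3 * e * f * g := by
    have : 2 * e ^ 2 * (3 * b - (e + 3 * e * f * g)) = 0 := by
      linear_combination -9 * he + (6 * b - 2 * e) * he2 - 3 * a * hf + 6 * e * f * hg
    simpa [h2, he0, sub_eq_zero] using this
  have hc3 : 3 * c = 2 * f + 3 * f ^ 2 * g := by
    have : e ^ 2 * (3 * c - (2 * f + 3 * f ^ 2 * g)) = 0 := by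
      linear_combination 27 * hc + 3 * c * he2 + 3 * a * hf2 + 3 * b * (-hf) - 3 * f ^ 2 * hg +
        2 * e * f * hb3
    simpa [he0, sub_eq_zero] using this
  have hd3 : e * d = f ^ 2 * (1 + f * g) := by
    have : 3 * e * (e * d - f ^ 2 * (1 + f * g)) = 0 := by
      linear_combination 27 * hd + 3 * d * he2 + 3 * b * hf2 - 3 * c * hf - f ^ 2 * hb3 +
        2 * e * f * hc3
    simpa [h3, he0, sub_eq_zero] using this
  refine ⟨e, f, g, h, hg, ?_, ?_, ?_, ?_⟩
  · linear_combination hb3 - e * hh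
  · linear_combination hc3 - 2 * f * hh
  · apply mul_left_cancel₀ he0
    linear_combination hd3 - f ^ 2 * hh
  · linear_combination hh

lemma exists_coeffs {k : Type*} [Field k] (h2 : (2 : k) ≠ 0) (h3 : (3 : k) ≠ 0)
    (P : BinCubic k) (hmu : mu P ≠ 0) (hnil : mu P ^ 2 = 0) :
    ∃ e f g h : k, P.a = e ^ 2 * g ∧ 3 * P.b = e ^ 2 * h + 2 * e * f * g ∧
      3 * P.c = 2 * e * f * h + f ^ 2 * g ∧ P.d = f ^ 2 * h ∧ e * h - f * g = 1 := by
  obtain ⟨a, b, c, d⟩ := P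
  have hdisc : (a * d - b * c) ^ 2 = 4 * (b ^ 2 - a * c) * (c ^ 2 - b * d) := by
    have h00 := congrFun (congrFun hnil 0) 0
    simp [mu, pow_two, Matrix.mul_apply, Fin.sum_univ_two] at h00
    linear_combination h00
  by_cases hA : b ^ 2 - a * c = 0
  · by_cases hD : c ^ 2 - b * d = 0
    · refine absurd ?_ hmu
      have hB : a * d - b * c = 0 := by
        apply pow_eq_zero_iff two_ne_zero |>.mp
        rw [hdisc, hA]; ring
      have hD' : b * d - c ^ 2 = 0 := by linear_combination -hD
      ext i j
      fin_cases i <;> fin_cases j <;> simp [mu, hA, hB, hD']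
    · obtain ⟨e, f, g, h, h₁, h₂, h₃, h₄, h₅⟩ :=
        exists_coeffs_of_hessian_ne_zero (a := d) (b := c) (c := b) (d := a) h2 h3
          (by convert hD using 2; ring) (by linear_combination hdisc)
      refine ⟨-f, -e, h, g, ?_, ?_, ?_, ?_, ?_⟩
      · linear_combination h₄
      · linear_combination h₃
      · linear_combination h₂
      · linear_combination h₁
      · linear_combination h₅
  · exact exists_coeffs_of_hessian_ne_zero h2 h3 hA hdisc

lemma eq_of_sq_eq_of_cube_eq {k : Type*} [Field k] {x y : k} (hsq : x ^ 2 = y ^ 2)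
    (hcube : x ^ 3 = y ^ 3) : x = y := by
  by_cases hy : y = 0
  · subst hy
    simpa using hsq
  · apply mul_left_cancel₀ (pow_ne_zero 2 hy)
    linear_combination hcube - x * hsq

/-- The coefficients of `φ` and `ξ` are determined by those of `φ²ξ` when `Ω(φ,ξ) = 1`. -/
lemma coeffs_unique {k : Type*} [Field k] (h2 : (2 : k) ≠ 0)
    {a b c d e f g h e' f' g' h' : k}
    (ha : a = e ^ 2 * g) (hb : b = e ^ 2 * h + 2 * e * f * g)
    (hc : c = 2 * e * f * h + f ^ 2 * g) (hd : d = f ^ 2 * h) (hΩ : e * h - f * g = 1)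
    (ha' : a = e' ^ 2 * g') (hb' : b = e' ^ 2 * h' + 2 * e' * f' * g')
    (hc' : c = 2 * e' * f' * h' + f' ^ 2 * g') (hd' : d = f' ^ 2 * h')
    (hΩ' : e' * h' - f' * g' = 1) :
    e = e' ∧ f = f' ∧ g = g' ∧ h = h' := by
  have key : ∀ {e f g h : k}, a = e ^ 2 * g → b = e ^ 2 * h + 2 * e * f * g →
      c = 2 * e * f * h + f ^ 2 * g → d = f ^ 2 * h → e * h - f * g = 1 →
      e ^ 2 = b ^ 2 - 3 * a * c ∧ f ^ 2 = c ^ 2 - 3 * b * d ∧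
      2 * e ^ 3 = 3 * a * (9 * a * d - b * c) + 2 * b * (b ^ 2 - 3 * a * c) ∧
      -2 * f ^ 3 = 3 * d * (9 * a * d - b * c) + 2 * c * (c ^ 2 - 3 * b * d) := by
    rintro e f g h rfl rfl rfl rfl hΩ
    have hΩ2 : (e * h - f * g) ^ 2 = 1 := by rw [hΩ, one_pow]
    have hΩ3 : (e * h - f * g) ^ 3 = 1 := by rw [hΩ, one_pow]
    refine ⟨?_, ?_, ?_, ?_⟩
    · linear_combination -e ^ 2 * hΩ2
    · linear_combination -f ^ 2 * hΩ2
    · linear_combination -2 * e ^ 3 * hΩ3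
    · linear_combination 2 * f ^ 3 * hΩ3
  obtain ⟨s₁, s₂, s₃, s₄⟩ := key ha hb hc hd hΩ
  obtain ⟨t₁, t₂, t₃, t₄⟩ := key ha' hb' hc' hd' hΩ'
  obtain rfl : e = e' := eq_of_sq_eq_of_cube_eq (s₁.trans t₁.symm)
    (mul_left_cancel₀ h2 (s₃.trans t₃.symm))
  obtain rfl : f = f' := eq_of_sq_eq_of_cube_eq (s₂.trans t₂.symm)
    (mul_left_cancel₀ (neg_ne_zero.mpr h2) (s₄.trans t₄.symm))
  refine ⟨rfl, rfl, ?_, ?_⟩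
  · by_cases he : e = 0
    · subst he
      have hf : f ≠ 0 := by rintro rfl; simp at hΩ
      apply mul_left_cancel₀ hf
      linear_combination hΩ' - hΩ
    · exact mul_left_cancel₀ (pow_ne_zero 2 he) (ha.symm.trans ha')
  · by_cases hf : f = 0
    · subst hf
      have he : e ≠ 0 := by rintro rfl; simp at hΩ
      apply mul_left_cancel₀ he
      linear_combination hΩ - hΩ'
    · exact mul_left_cancel₀ (pow_ne_zero 2 hf) (hd.symm.trans hd')

end BinCubic

/-- if `μ(P)` is nonzero nilpotent, there is a unique pair of linear forms
`(φ, ξ)` with `P = φ²ξ` and `Ω(φ,ξ) = 1`. -/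
theorem stmt9 {k : Type*} [Field k] (h2 : (2 : k) ≠ 0) (h3 : (3 : k) ≠ 0)
    (P : BinCubic k) (hmu : mu P ≠ 0) (hnil : mu P ^ 2 = 0) :
    ∃! pq : (k × k) × (k × k),
      toPoly P = lin pq.1.1 pq.1.2 ^ 2 * lin pq.2.1 pq.2.2 ∧
        pq.1.1 * pq.2.2 - pq.1.2 * pq.2.1 = 1 := by
  obtain ⟨e, f, g, h, ha, hb, hc, hd, hΩ⟩ := exists_coeffs h2 h3 P hmu hnil
  refine ⟨((e, f), (g, h)),
    ⟨(toPoly_eq_lin_sq_mul_lin_iff P e f g h).2 ⟨ha, hb, hc, hd⟩, hΩ⟩, ?_⟩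
  rintro ⟨⟨e', f'⟩, ⟨g', h'⟩⟩ ⟨hP', hΩ'⟩
  obtain ⟨ha', hb', hc', hd'⟩ := (toPoly_eq_lin_sq_mul_lin_iff P e' f' g' h').1 hP'
  obtain ⟨rfl, rfl, rfl, rfl⟩ := coeffs_unique h2 ha' hb' hc' hd' hΩ' ha hb hc hd hΩ
  rfl
end

section
/- SL(2,k) acts simply transitively on the set N_μ of binary cubics whose moment map is nonzero and nilpotent: for any two binary cubics P, P' over k with μ(P) and μ(P') both nonzero and nilpotent, there exists a unique g ∈ SL(2,k) such that g·P = P'. -/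
open MvPolynomial

open BinCubic

namespace BinCubic

variable {k : Type*} [Field k]

theorem toPoly_injective (h3 : (3 : k) ≠ 0) :
    Function.Injective (toPoly : BinCubic k → MvPolynomial (Fin 2) k) := by
  intro P Q h
  have key (R : BinCubic k) : aeval ![(Polynomial.X : Polynomial k), 1] (toPoly R) =
      Polynomial.C R.a * Polynomial.X ^ 3 + Polynomial.C (3 * R.b) * Polynomial.X ^ 2 +
        Polynomial.C (3 * R.c) * Polynomial.X + Polynomial.C R.d := by
    simp [toPoly]
  have h' := congrArg (aeval ![(Polynomial.X : Polynomial k), 1]) h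
  rw [key, key] at h'
  have hcoeff (n : ℕ) := congrArg (Polynomial.coeff · n) h'
  have ha := hcoeff 3
  have hb := hcoeff 2
  have hc := hcoeff 1
  have hd := hcoeff 0
  simp only [Polynomial.coeff_add, Polynomial.coeff_C_mul, Polynomial.coeff_X_pow,
    Polynomial.coeff_X, Polynomial.coeff_C] at ha hb hc hd
  norm_num [h3] at ha hb hc hd
  cases P
  cases Q
  simp_all

theorem slAct_toPoly (g : Matrix (Fin 2) (Fin 2) k) (P : BinCubic k) :
    slAct g (toPoly P) = toPoly (substAct (g 1 1) (-g 0 1) (-g 1 0) (g 0 0) P) := by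
  have hC2 : (C 2 : MvPolynomial (Fin 2) k) = 2 := map_ofNat C 2
  have hC3 : (C 3 : MvPolynomial (Fin 2) k) = 3 := map_ofNat C 3
  simp [slAct, toPoly, substAct]
  simp only [hC2, hC3]
  ring

theorem slAct_mul (g h : Matrix (Fin 2) (Fin 2) k) (p : MvPolynomial (Fin 2) k) :
    slAct (g * h) p = slAct g (slAct h p) := by
  unfold slAct
  rw [← AlgHom.comp_apply]
  congr 1
  ext i : 1
  fin_cases i <;> simp [Matrix.mul_apply, Fin.sum_univ_two] <;> ring

theorem slAct_one (p : MvPolynomial (Fin 2) k) : slAct 1 p = p := by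
  have h : ![C ((1 : Matrix (Fin 2) (Fin 2) k) 1 1) * X 0 -
        C ((1 : Matrix (Fin 2) (Fin 2) k) 0 1) * X 1,
      C ((1 : Matrix (Fin 2) (Fin 2) k) 0 0) * X 1 -
        C ((1 : Matrix (Fin 2) (Fin 2) k) 1 0) * X 0] =
      (X : Fin 2 → MvPolynomial (Fin 2) k) := by
    ext1 i
    fin_cases i <;> simp
  rw [slAct, h, aeval_X_left_apply]

/-- A binary cubic with nonzero nilpotent moment map is `3 φ² ψ` for linear forms `φ`, `ψ`
of determinant one. -/
theorem exists_substAct_eq (h2 : (2 : k) ≠ 0) (h3 : (3 : k) ≠ 0) (P : BinCubic k)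
    (hmu : mu P ≠ 0) (hnil : mu P ^ 2 = 0) :
    ∃ p q r s : k, p * s - q * r = 1 ∧ substAct p q r s ⟨0, 1, 0, 0⟩ = P := by
  obtain ⟨a, b, c, d⟩ := P
  have hK : (a * d - b * c) ^ 2 = 4 * (b ^ 2 - a * c) * (c ^ 2 - b * d) := by
    have h := congrFun (congrFun hnil 0) 0
    simp [mu, pow_two, Matrix.mul_apply, Fin.sum_univ_two] at h
    linear_combination h
  by_cases hH : b ^ 2 - a * c = 0
  · have hK0 : a * d - b * c = 0 := by
      rw [hH] at hK
      simpa using hK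
    have hL : c ^ 2 - b * d ≠ 0 := by
      intro hL
      apply hmu
      have hL' : b * d - c ^ 2 = 0 := by linear_combination -hL
      ext i j
      fin_cases i <;> fin_cases j <;> simp [mu, hH, hK0, hL']
    have ha : a = 0 := by
      have : a * (c ^ 2 - b * d) = 0 := by linear_combination -c * hH - b * hK0
      exact (mul_eq_zero.mp this).resolve_right hL
    subst ha
    have hb : b = 0 := by simpa using hH
    subst hb
    have hc : c ≠ 0 := by
      rintro rfl
      simp at hL
    refine ⟨0, -c, 1 / c, d / (3 * c ^ 2), by field_simp; ring, ?_⟩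
    simp only [substAct, BinCubic.mk.injEq]
    refine ⟨?_, ?_, ?_, ?_⟩ <;> field_simp <;> ring
  · obtain ⟨H, hHdef⟩ : ∃ H, H = b ^ 2 - a * c := ⟨_, rfl⟩
    obtain ⟨K, hKdef⟩ : ∃ K, K = a * d - b * c := ⟨_, rfl⟩
    rw [← hHdef] at hH hK
    rw [← hKdef] at hK
    obtain ⟨p, hp⟩ : ∃ p, p = (2 * b * H + a * K) / (2 * H) := ⟨_, rfl⟩
    have hpH : 2 * H * p = 2 * b * H + a * K := by rw [hp]; field_simp
    have hp2 : p ^ 2 = H := by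
      have : 4 * H ^ 2 * (p ^ 2 - H) = 0 := by
        have e : 4 * H ^ 2 * p ^ 2 = (2 * b * H + a * K) ^ 2 := by rw [← hpH]; ring
        have e2 : b ^ 2 * H + a * b * K + a ^ 2 * (c ^ 2 - b * d) = H ^ 2 := by
          rw [hHdef, hKdef]; ring
        linear_combination e + a ^ 2 * hK + 4 * H * e2
      have h4 : (4 : k) * H ^ 2 ≠ 0 := by
        have : (4 : k) = 2 * 2 := by norm_num
        rw [this]
        exact mul_ne_zero (mul_ne_zero h2 h2) (pow_ne_zero 2 hH)
      exact sub_eq_zero.mp ((mul_eq_zero.mp this).resolve_left h4)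
    have hp0 : p ≠ 0 := by
      rintro rfl
      exact hH (by rw [← hp2]; ring)
    obtain ⟨q, hq⟩ : ∃ q, K = -2 * p * q := ⟨-K / (2 * p), by field_simp⟩
    obtain ⟨r, hr⟩ : ∃ r, a = 3 * p ^ 2 * r := ⟨a / (3 * p ^ 2), by field_simp⟩
    have hL : c ^ 2 - b * d = q ^ 2 := by
      refine mul_left_cancel₀ (mul_ne_zero (mul_ne_zero h2 h2) hH) ?_
      rw [hq] at hK
      linear_combination -hK + 4 * q ^ 2 * hp2
    have hb : b = p + 3 * p * q * r := by
      refine mul_left_cancel₀ (mul_ne_zero h2 hH) ?_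
      rw [hq, hr, ← hp2] at hpH
      rw [← hp2]
      linear_combination -hpH
    have hc : c = 2 * q + 3 * q ^ 2 * r := by
      refine mul_left_cancel₀ hH ?_
      have e : a * (c ^ 2 - b * d) + b * K + c * H = 0 := by rw [hHdef, hKdef]; ring
      rw [hL, hq, hr, hb, ← hp2] at e
      rw [← hp2]
      linear_combination e
    have hd : d = 3 * q ^ 2 * ((1 + q * r) / p) := by
      have e : b * (c ^ 2 - b * d) + c * K + d * H = 0 := by rw [hHdef, hKdef]; ring
      rw [hL, hq, hb, hc, ← hp2] at e
      field_simp
      refine mul_left_cancel₀ hp0 ?_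
      linear_combination e
    refine ⟨p, q, r, (1 + q * r) / p, by field_simp; ring, ?_⟩
    simp only [substAct, BinCubic.mk.injEq]
    rw [hr, hb, hc, hd]
    refine ⟨?_, ?_, ?_, ?_⟩ <;> field_simp <;> ring

theorem eq_one_of_slAct_eq (h2 : (2 : k) ≠ 0) (h3 : (3 : k) ≠ 0) (g : Matrix.SpecialLinearGroup (Fin 2) k)
    (h : slAct (↑g) (toPoly (⟨0, 1, 0, 0⟩ : BinCubic k)) = toPoly ⟨0, 1, 0, 0⟩) : g = 1 := by
  rw [slAct_toPoly] at h
  have h := toPoly_injective h3 h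
  have hdet := g.det_coe
  rw [Matrix.det_fin_two] at hdet
  simp only [substAct, BinCubic.mk.injEq] at h
  obtain ⟨ha, hb, hc, -⟩ := h
  have hp : g 1 1 ≠ 0 := by
    intro hp
    simp [hp] at hb
  have hr : g 1 0 = 0 := by
    have : 3 * (g 1 1) ^ 2 * g 1 0 = 0 := by linear_combination -ha
    simpa [h3, hp] using this
  simp only [hr] at hb hc hdet
  have hp1 : g 1 1 = 1 := by linear_combination hb - g 1 1 * hdet
  have hs1 : g 0 0 = 1 := by simpa [hp1] using hdet
  have hq : g 0 1 = 0 := by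
    simpa [hp1, hs1, h2] using hc
  ext i j
  fin_cases i <;> fin_cases j <;> simp [hr, hp1, hs1, hq]

/-- A binary cubic with nonzero nilpotent moment map lies in the `SL(2,k)`-orbit of `3x²y`. -/
theorem exists_slAct_eq (h2 : (2 : k) ≠ 0) (h3 : (3 : k) ≠ 0) (P : BinCubic k)
    (hmu : mu P ≠ 0) (hnil : mu P ^ 2 = 0) :
    ∃ g : Matrix.SpecialLinearGroup (Fin 2) k,
      slAct (↑g) (toPoly (⟨0, 1, 0, 0⟩ : BinCubic k)) = toPoly P := by
  obtain ⟨p, q, r, s, hdet, hP⟩ := exists_substAct_eq h2 h3 P hmu hnil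
  refine ⟨⟨!![s, -q; -r, p], ?_⟩, ?_⟩
  · rw [Matrix.det_fin_two_of]
    linear_combination hdet
  · rw [slAct_toPoly]
    simp [hP]

end BinCubic

/-- `SL(2,k)` acts simply transitively on the set of binary cubics whose
moment map is nonzero nilpotent. -/
theorem stmt10 {k : Type*} [Field k] (h2 : (2 : k) ≠ 0) (h3 : (3 : k) ≠ 0)
    (P P' : BinCubic k)
    (hmu : mu P ≠ 0) (hnil : mu P ^ 2 = 0)
    (hmu' : mu P' ≠ 0) (hnil' : mu P' ^ 2 = 0) :
    ∃! g : Matrix.SpecialLinearGroup (Fin 2) k,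
      slAct (↑g) (toPoly P) = toPoly P' := by
  obtain ⟨g₁, hg₁⟩ := exists_slAct_eq h2 h3 P hmu hnil
  obtain ⟨g₂, hg₂⟩ := exists_slAct_eq h2 h3 P' hmu' hnil'
  have inv_act (g : Matrix.SpecialLinearGroup (Fin 2) k) {p q : MvPolynomial (Fin 2) k}
      (h : slAct (↑g) p = q) : slAct (↑g⁻¹) q = p := by
    rw [← h, ← slAct_mul, ← Matrix.SpecialLinearGroup.coe_mul, inv_mul_cancel,
      Matrix.SpecialLinearGroup.coe_one, slAct_one]
  refine ⟨g₂ * g₁⁻¹, ?_, fun g hg => ?_⟩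
  · simp only [Matrix.SpecialLinearGroup.coe_mul, slAct_mul]
    rw [inv_act g₁ hg₁, hg₂]
  · have h := eq_one_of_slAct_eq h2 h3 (g₂⁻¹ * (g * g₁)) (by
      simp only [Matrix.SpecialLinearGroup.coe_mul, slAct_mul]
      rw [hg₁, hg, inv_act g₂ hg₂])
    rw [eq_mul_inv_iff_mul_eq]
    exact (inv_mul_eq_one.mp h).symm
end
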